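/- Gradient bound at an unsuccessful iteration in the noisy case (Lemma B.5). Let x ∈ E and α > 0. If f(x) − f(x + α • v) ≤ (3c/2) α² for every v ∈ D, then ‖∇f(x)‖ ≤ (1/(2κ))(β + 3c) α. -/

import Mathlib

open RealInnerProductSpace Finset

/-- The descent lemma: a function with `β`-Lipschitz gradient is bounded above by its
quadratic model. -/
theorem le_add_inner_gradient_add_sq {E : Type*} [NormedAddCommGroup E] [InnerProductSpace ℝ E]
    [CompleteSpace E] {f : E → ℝ} {β : ℝ} (hf : Differentiable ℝ f)
    (hsmooth : ∀ x y : E, ‖gradient f x - gradient f y‖ ≤ β * ‖x - y‖) (x w : E) :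
    f (x + w) ≤ f x + ⟪gradient f x, w⟫ + β / 2 * ‖w‖ ^ 2 := by
  let h : ℝ → ℝ := fun t => t * ⟪gradient f x, w⟫ + β / 2 * ‖w‖ ^ 2 * t ^ 2 - f (x + t • w)
  have hderiv (t : ℝ) : HasDerivAt h
      (⟪gradient f x, w⟫ + β * ‖w‖ ^ 2 * t - ⟪gradient f (x + t • w), w⟫) t := by
    have hline : HasDerivAt (fun t : ℝ => x + t • w) w t := by
      simpa using ((hasDerivAt_id t).smul_const w).const_add x
    have hcomp : HasDerivAt (fun t : ℝ => f (x + t • w)) ⟪gradient f (x + t • w), w⟫ t := by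
      simpa [Function.comp_def] using
        (hf (x + t • w)).hasGradientAt.hasFDerivAt.comp_hasDerivAt t hline
    have hlin : HasDerivAt (fun t : ℝ => t * ⟪gradient f x, w⟫) ⟪gradient f x, w⟫ t := by
      simpa using (hasDerivAt_id t).mul_const ⟪gradient f x, w⟫
    have hquad : HasDerivAt (fun t : ℝ => β / 2 * ‖w‖ ^ 2 * t ^ 2) (β * ‖w‖ ^ 2 * t) t := by
      refine ((hasDerivAt_pow 2 t).const_mul (β / 2 * ‖w‖ ^ 2)).congr_deriv ?_
      push_cast
      ring
    exact (hlin.add hquad).sub hcomp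
  have hmono : MonotoneOn h (Set.Icc 0 1) := by
    refine monotoneOn_of_deriv_nonneg (convex_Icc 0 1)
      (fun t _ => (hderiv t).continuousAt.continuousWithinAt)
      (fun t _ => (hderiv t).differentiableAt.differentiableWithinAt) fun t ht => ?_
    rw [interior_Icc] at ht
    rw [(hderiv t).deriv]
    have hcs := real_inner_le_norm (gradient f (x + t • w) - gradient f x) w
    have hlip := mul_le_mul_of_nonneg_right (hsmooth (x + t • w) x) (norm_nonneg w)
    rw [add_sub_cancel_left, norm_smul, Real.norm_of_nonneg ht.1.le] at hlip
    rw [inner_sub_left] at hcs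
    linarith
  have h01 := hmono (Set.left_mem_Icc.2 zero_le_one) (Set.right_mem_Icc.2 zero_le_one) zero_le_one
  simp only [h, zero_smul, one_smul, add_zero] at h01
  linarith

theorem stmt10 {d : ℕ} (hd : 1 ≤ d)
    (f : EuclideanSpace ℝ (Fin d) → ℝ) (a β : ℝ) (ha : 0 < a) (hβ : 0 < β)
    (hdiff : ContDiff ℝ 1 f)
    (hsmooth : ∀ x y : EuclideanSpace ℝ (Fin d), ‖gradient f x - gradient f y‖ ≤ β * ‖x - y‖)
    (hconv : ∀ x y : EuclideanSpace ℝ (Fin d),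
      f y ≥ f x + ⟪gradient f x, y - x⟫ + a * ‖y - x‖ ^ 2)
    (D : Finset (EuclideanSpace ℝ (Fin d))) (hDne : D.Nonempty)
    (hunit : ∀ v ∈ D, ‖v‖ = 1) (κ : ℝ) (hκ : 0 < κ)
    (hcm : ∀ u : EuclideanSpace ℝ (Fin d), u ≠ 0 → ∃ v ∈ D, ⟪u, v⟫ ≥ κ * ‖u‖)
    (c : ℝ) (hc : 0 < c) (p : EuclideanSpace ℝ (Fin d)) (αp : ℝ) (hαp : 0 < αp)
    (hunsucc : ∀ v ∈ D, f p - f (p + αp • v) ≤ (3 * c / 2) * αp ^ 2) :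
    ‖gradient f p‖ ≤ (1 / (2 * κ)) * (β + 3 * c) * αp := by
  by_cases hg : gradient f p = 0
  · rw [hg, norm_zero]
    positivity
  obtain ⟨v, hv, hκv⟩ := hcm (-gradient f p) (neg_ne_zero.2 hg)
  rw [inner_neg_left, norm_neg] at hκv
  have hdesc := le_add_inner_gradient_add_sq (hdiff.differentiable one_ne_zero) hsmooth p (αp • v)
  rw [inner_smul_right, norm_smul, hunit v hv, Real.norm_of_nonneg hαp.le, mul_one] at hdesc
  have hbound : αp * (κ * ‖gradient f p‖) ≤ αp * ((β + 3 * c) / 2 * αp) := by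
    linarith [mul_le_mul_of_nonneg_left hκv hαp.le, hunsucc v hv]
  have hκg := le_of_mul_le_mul_left hbound hαp
  calc ‖gradient f p‖ ≤ (β + 3 * c) / 2 * αp / κ := by rwa [le_div_iff₀' hκ]
    _ = (1 / (2 * κ)) * (β + 3 * c) * αp := by
      field_simp
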